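/- Let k ≥ 1 and let T be a complete multidigraph on a finite nonempty vertex set V whose arc set is the union of k quasi-orders P_1, …, P_k. Then the domination number of T satisfies γ(T) ≤ k^{k+1} · g(1/(2k)), where g(ε) = ⌊ln(ε)/ln(1-ε)⌋ + 1; that is, there exists a set S ⊆ V with |S| ≤ k^{k+1} · (⌊ln(1/(2k))/ln(1 - 1/(2k))⌋ + 1) such that every vertex v ∈ V satisfies v ∈ S or P_i s v for some s ∈ S and some i ∈ {1,…,k}. -/

import Mathlib

/-- `g(ε) = ⌊ln(ε)/ln(1-ε)⌋ + 1`. -/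
noncomputable def gfun (ε : ℝ) : ℕ :=
  Nat.floor (Real.log ε / Real.log (1 - ε)) + 1

open Finset in
/-- A symmetric zero-sum game on a finite set has a mixed strategy with nonnegative payoff. -/
theorem exists_mem_stdSimplex_forall_sum_mul_nonneg {ι : Type*} [Fintype ι] [Nonempty ι]
    (M : ι → ι → ℝ) (hM : ∀ x y, M y x = -M x y) :
    ∃ w ∈ stdSimplex ℝ ι, ∀ x, 0 ≤ ∑ y, w y * M y x := by
  classical
  by_contra! hneg
  let L : (ι → ℝ) →ₗ[ℝ] (ι → ℝ) := Matrix.vecMulLinear M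
  have hL : ∀ w x, L w x = ∑ y, w y * M y x := fun w x => rfl
  obtain ⟨f, a, b, hfa, hab, hfb⟩ := geometric_hahn_banach_compact_closed
    ((convex_stdSimplex ℝ ι).linear_image L)
    ((isCompact_stdSimplex ℝ ι).image L.continuous_of_finiteDimensional)
    (convex_Ici (0 : ι → ℝ)) isClosed_Ici (by
      rw [Set.disjoint_left]
      rintro _ ⟨w, hw, rfl⟩ h
      obtain ⟨x, hx⟩ := hneg w hw
      exact absurd (h x) (by simpa [hL] using hx))
  have hb : b < 0 := by simpa using hfb 0 (by simp)
  set c : ι → ℝ := fun x => f (Pi.single x 1) with hc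
  have hf : ∀ v, f v = ∑ x, v x * c x := by
    intro v
    conv_lhs => rw [pi_eq_sum_univ' v]
    simp [hc, map_sum]
  have hc0 : ∀ x, 0 ≤ c x := by
    intro x
    by_contra! hx
    have h := hfb (Pi.single x (b / c x)) (by
      simpa using (div_pos_of_neg_of_neg hb hx).le)
    rw [hf, Finset.sum_eq_single x (by simp +contextual) (by simp)] at h
    simp [hx.ne] at h
  have hskew : ∑ x, (∑ y, c y * M y x) * c x = 0 := by
    have h : ∑ x, ∑ y, c y * M y x * c x = -∑ x, ∑ y, c y * M y x * c x := by
      conv_lhs => rw [sum_comm]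
      rw [← sum_neg_distrib]
      refine sum_congr rfl fun x _ => ?_
      rw [← sum_neg_distrib]
      refine sum_congr rfl fun y _ => ?_
      rw [hM y x]
      ring
    simp only [sum_mul]
    linarith
  have hs : 0 < ∑ x, c x := by
    refine (sum_nonneg fun x _ => hc0 x).lt_of_ne' fun h0 => ?_
    have hcz : ∀ x, c x = 0 := by
      simpa using (sum_eq_zero_iff_of_nonneg fun x _ => hc0 x).1 h0
    obtain ⟨i⟩ := ‹Nonempty ι›
    have h := hfa _ ⟨_, single_mem_stdSimplex ℝ i, rfl⟩
    rw [hf] at h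
    simp only [hcz, mul_zero, sum_const_zero] at h
    linarith
  have h := hfa _ ⟨(∑ x, c x)⁻¹ • c, ⟨fun x => mul_nonneg (inv_nonneg.2 hs.le) (hc0 x), by
    simp [← mul_sum, hs.ne']⟩, rfl⟩
  rw [map_smul, map_smul, hf] at h
  simp only [hL, hskew, smul_zero] at h
  linarith

open Finset Classical in
/-- A finite complete digraph carries a probability distribution giving weight at least `1/2` to
every closed in-neighbourhood. -/
theorem exists_mem_stdSimplex_half_le {ι : Type*} [Fintype ι] [Nonempty ι]
    (R : ι → ι → Prop) (hR : ∀ x y, R x y ∨ R y x) :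
    ∃ w ∈ stdSimplex ℝ ι, ∀ x, 1 / 2 ≤ ∑ y with R y x, w y := by
  obtain ⟨w, hw, h⟩ := exists_mem_stdSimplex_forall_sum_mul_nonneg
    (fun y x => (if R y x then (1 : ℝ) else 0) - if R x y then 1 else 0) (by intros; ring)
  refine ⟨w, hw, fun x => ?_⟩
  have hx := h x
  have key : ∑ y, w y ≤ ∑ y, (2 * (if R y x then w y else 0) -
      w y * ((if R y x then (1 : ℝ) else 0) - if R x y then 1 else 0)) := by
    refine sum_le_sum fun y _ => ?_
    have := hw.1 y
    rcases hR x y with h1 | h1 <;> split_ifs <;> first | contradiction | linarith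
  rw [sum_sub_distrib, ← mul_sum, hw.2] at key
  rw [sum_filter]
  linarith

open Finset Classical in
/-- The distribution of `exists_mem_stdSimplex_half_le` for a sub-digraph, extended by zero. -/
theorem exists_mem_stdSimplex_half_le_of_subset {V : Type*} [Fintype V]
    (R : V → V → Prop) (hR : ∀ x y, R x y ∨ R y x) {A : Finset V} (hA : A.Nonempty) :
    ∃ w ∈ stdSimplex ℝ V, (∀ y ∉ A, w y = 0) ∧ ∀ x ∈ A, 1 / 2 ≤ ∑ y with R y x, w y := by
  have := hA.to_subtype
  obtain ⟨w, hw, h⟩ := exists_mem_stdSimplex_half_le (ι := A) (fun x y => R x y)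
    (fun x y => hR x y)
  have hsum : ∀ p : V → Prop, ∑ y, (if p y then (if h : y ∈ A then w ⟨y, h⟩ else 0) else 0) =
      ∑ a : A, if p a then w a else 0 := by
    intro p
    rw [← sum_subset (subset_univ A) (by simp +contextual), ← sum_coe_sort]
    simp
  refine ⟨fun y => if h : y ∈ A then w ⟨y, h⟩ else 0, ⟨fun y => ?_, ?_⟩, ?_, fun x hx => ?_⟩
  · dsimp only
    split_ifs
    exacts [hw.1 _, le_rfl]
  · have h := hsum fun _ => True
    simp only [if_true] at h
    exact h.trans hw.2
  · intro y hy
    simp [hy]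
  · rw [sum_filter, hsum]
    simpa [sum_filter] using h ⟨x, hx⟩

open Finset Classical in
/-- Greedy choice: if every vertex in the support of `u` has an in-neighbourhood of `w`-weight at
least `ε`, then `n` vertices leave at most a `(1 - ε) ^ n` fraction of `u` undominated. -/
theorem exists_card_le_sum_undominated_le {V : Type*} [Fintype V] (Q : V → V → Prop)
    {w u : V → ℝ} {ε : ℝ} (hε : ε ≤ 1) (hw : w ∈ stdSimplex ℝ V) (hu : ∀ y, 0 ≤ u y)
    (hQ : ∀ y, u y ≠ 0 → ε ≤ ∑ b with Q b y, w b) (n : ℕ) :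
    ∃ S : Finset V, S.card ≤ n ∧
      ∑ y with ∀ s ∈ S, ¬ Q s y, u y ≤ (1 - ε) ^ n * ∑ y, u y := by
  induction n with
  | zero => exact ⟨∅, by simp⟩
  | succ n ih =>
    obtain ⟨S, hS, hle⟩ := ih
    set U : Finset V := {y | ∀ s ∈ S, ¬ Q s y} with hU
    obtain ⟨b, hb⟩ : ∃ b, ε * ∑ y ∈ U, u y ≤ ∑ y ∈ U with Q b y, u y := by
      by_contra! hlt
      have hdouble : ∑ b, w b * ∑ y ∈ U with Q b y, u y =
          ∑ y ∈ U, u y * ∑ b with Q b y, w b := by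
        simp only [sum_filter, mul_sum]
        rw [sum_comm]
        refine sum_congr rfl fun y _ => sum_congr rfl fun b _ => ?_
        split_ifs <;> ring
      have hge : ε * ∑ y ∈ U, u y ≤ ∑ y ∈ U, u y * ∑ b with Q b y, w b := by
        rw [mul_sum]
        refine sum_le_sum fun y _ => ?_
        by_cases h0 : u y = 0
        · simp [h0]
        · rw [mul_comm]
          exact mul_le_mul_of_nonneg_left (hQ y h0) (hu y)
      have hlt' : ∑ b, w b * ∑ y ∈ U with Q b y, u y < ∑ b, w b * (ε * ∑ y ∈ U, u y) := by
        obtain ⟨b, hb⟩ : ∃ b, 0 < w b := by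
          by_contra! h
          have := sum_nonpos fun b (_ : b ∈ univ) => h b
          linarith [hw.2]
        exact sum_lt_sum (fun b _ => mul_le_mul_of_nonneg_left (hlt b).le (hw.1 b))
          ⟨b, mem_univ b, mul_lt_mul_of_pos_left (hlt b) hb⟩
      rw [← sum_mul, hw.2, one_mul] at hlt'
      linarith
    refine ⟨insert b S, (card_insert_le _ _).trans (by omega), ?_⟩
    have hsplit := sum_filter_add_sum_filter_not U (Q b) u
    have heq : (univ.filter fun y => ∀ s ∈ insert b S, ¬ Q s y) = U.filter fun y => ¬ Q b y := by
      ext y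
      simp [hU, and_comm]
    rw [heq, pow_succ]
    have := mul_le_mul_of_nonneg_left hle (sub_nonneg.2 hε)
    linarith

/-- `gfun ε` steps suffice to push `(1 - ε) ^ n` below `ε`. -/
theorem one_sub_pow_gfun_lt {ε : ℝ} (h0 : 0 < ε) (h1 : ε < 1) : (1 - ε) ^ gfun ε < ε := by
  have hlog : Real.log (1 - ε) < 0 := Real.log_neg (by linarith) (by linarith)
  have h : Real.log ε / Real.log (1 - ε) < gfun ε := by
    unfold gfun
    exact_mod_cast Nat.lt_floor_add_one _
  rw [div_lt_iff_of_neg hlog, ← Real.log_pow] at h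
  exact (Real.log_lt_log_iff (pow_pos (by linarith) _) h0).1 h

open Finset Classical in
/-- Two nested distributions in which in-neighbourhoods have weight at least `ε` yield, for a
transitive relation, a dominating set of size `gfun ε`. -/
theorem exists_card_le_gfun_dominating {V : Type*} [Fintype V] {Q : V → V → Prop}
    (htrans : ∀ x y z, Q x y → Q y z → Q x z) {w u : V → ℝ} {ε : ℝ} (h0 : 0 < ε) (h1 : ε < 1)
    (hw : w ∈ stdSimplex ℝ V) (hu : u ∈ stdSimplex ℝ V)
    (hQ : ∀ y, u y ≠ 0 → ε ≤ ∑ b with Q b y, w b) :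
    ∃ S : Finset V, S.card ≤ gfun ε ∧
      ∀ x, ε ≤ ∑ y with Q y x, u y → ∃ s ∈ S, Q s x := by
  obtain ⟨S, hS, hle⟩ := exists_card_le_sum_undominated_le Q h1.le hw hu.1 hQ (gfun ε)
  refine ⟨S, hS, fun x hx => ?_⟩
  by_contra! hx'
  have hsub : ∑ y with Q y x, u y ≤ ∑ y with ∀ s ∈ S, ¬ Q s y, u y := by
    refine sum_le_sum_of_subset_of_nonneg (fun y hy => ?_) fun y _ _ => hu.1 y
    simp only [mem_filter, mem_univ, true_and] at hy ⊢
    exact fun s hs hsy => hx' s hs (htrans s y x hsy hy)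
  rw [hu.2, mul_one] at hle
  linarith [one_sub_pow_gfun_lt h0 h1]

open Finset Classical in
/-- A complete union of `k` relations carries, on each nonempty `A`, a distribution for which every
vertex of `A` has an in-neighbourhood of weight at least `1/(2k)` in some colour. -/
theorem exists_mem_stdSimplex_heavy_colour {V : Type*} [Fintype V] {k : ℕ} (hk : 1 ≤ k)
    (P : Fin k → V → V → Prop) (htotal : ∀ x y : V, (∃ i, P i x y) ∨ ∃ i, P i y x)
    {A : Finset V} (hA : A.Nonempty) :
    ∃ u ∈ stdSimplex ℝ V, (∀ y ∉ A, u y = 0) ∧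
      ∀ x ∈ A, ∃ i, 1 / (2 * (k : ℝ)) ≤ ∑ y with P i y x, u y := by
  obtain ⟨u, hu, huA, hhalf⟩ := exists_mem_stdSimplex_half_le_of_subset
    (fun x y => ∃ i, P i x y) htotal hA
  refine ⟨u, hu, huA, fun x hx => ?_⟩
  by_contra! hlt
  have hunion : ∑ y with ∃ i, P i y x, u y ≤ ∑ i, ∑ y with P i y x, u y := by
    simp only [sum_filter]
    rw [sum_comm]
    refine sum_le_sum fun y _ => ?_
    have hnonneg : ∀ i ∈ univ, 0 ≤ if P i y x then u y else 0 := by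
      intro i _
      split_ifs
      exacts [hu.1 y, le_rfl]
    split_ifs with h
    · obtain ⟨i, hi⟩ := h
      simpa only [hi, if_true] using single_le_sum hnonneg (mem_univ i)
    · exact sum_nonneg hnonneg
  have hsum : ∑ i, ∑ y with P i y x, u y < ∑ _i : Fin k, 1 / (2 * (k : ℝ)) :=
    sum_lt_sum_of_nonempty ⟨⟨0, hk⟩, mem_univ _⟩ fun i _ => hlt i
  have hhalf_eq : ∑ _i : Fin k, 1 / (2 * (k : ℝ)) = 1 / 2 := by
    have : (k : ℝ) ≠ 0 := by positivity
    rw [sum_const, card_univ, Fintype.card_fin, nsmul_eq_mul]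
    field_simp
  have hx' : 1 / 2 ≤ ∑ y with ∃ i, P i y x, u y := by convert hhalf x hx
  linarith

open Finset Classical in
/-- If for each colour `i ∈ J` all vertices of `A` have `P i`-in-neighbourhoods of weight at least
`1/(2k)` in some distribution, then `A` has a dominating set whose size is controlled by the
number of colours outside `J`. -/
theorem exists_dominating_of_heavy_colours {V : Type*} [Fintype V] {k : ℕ} (hk : 1 ≤ k)
    (P : Fin k → V → V → Prop)
    (htrans : ∀ i x y z, P i x y → P i y z → P i x z)
    (htotal : ∀ x y : V, (∃ i, P i x y) ∨ ∃ i, P i y x) (m : ℕ) (J : Finset (Fin k))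
    (hJ : J.card + m = k + 1) (W : Fin k → V → ℝ) (A : Finset V)
    (hW : ∀ i ∈ J, W i ∈ stdSimplex ℝ V ∧
      ∀ x ∈ A, 1 / (2 * (k : ℝ)) ≤ ∑ y with P i y x, W i y) :
    ∃ S : Finset V, S.card ≤ k ^ m * gfun (1 / (2 * (k : ℝ))) ∧
      ∀ v ∈ A, ∃ s ∈ S, ∃ i, P i s v := by
  induction m generalizing J W A with
  | zero =>
    have := card_le_univ J
    rw [Fintype.card_fin] at this
    omega
  | succ m ih =>
    have hk' : (1 : ℝ) ≤ k := by exact_mod_cast hk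
    set ε : ℝ := 1 / (2 * (k : ℝ)) with hε
    have hε0 : 0 < ε := by positivity
    have hε1 : ε < 1 := by
      rw [hε, div_lt_one (by positivity)]
      linarith
    rcases A.eq_empty_or_nonempty with rfl | hA
    · exact ⟨∅, by simp⟩
    obtain ⟨u, hu, huA, hheavy⟩ := exists_mem_stdSimplex_heavy_colour hk P htotal hA
    have hpart : ∀ i, ∃ S : Finset V, S.card ≤ k ^ m * gfun ε ∧
        ∀ v ∈ A, ε ≤ ∑ y with P i y v, u y → ∃ s ∈ S, ∃ j, P j s v := by
      intro i
      by_cases hi : i ∈ J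
      · obtain ⟨S, hS, hdom⟩ := exists_card_le_gfun_dominating (htrans i) hε0 hε1 (hW i hi).1 hu
          fun y hy => (hW i hi).2 y (by_contra fun h => hy (huA y h))
        refine ⟨S, hS.trans (Nat.le_mul_of_pos_left _ (by positivity)), fun v _ hv => ?_⟩
        obtain ⟨s, hs, hsv⟩ := hdom v hv
        exact ⟨s, hs, i, hsv⟩
      · obtain ⟨S, hS, hdom⟩ := ih (insert i J) (by rw [card_insert_of_notMem hi]; omega)
          (Function.update W i u) {v ∈ A | ε ≤ ∑ y with P i y v, u y} (by
            intro j hj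
            rcases eq_or_ne j i with rfl | hji
            · simpa using hu
            · have hjJ := (mem_insert.1 hj).resolve_left hji
              rw [Function.update_of_ne hji]
              exact ⟨(hW j hjJ).1, fun x hx => (hW j hjJ).2 x (mem_filter.1 hx).1⟩)
        exact ⟨S, hS, fun v hv h => hdom v (mem_filter.2 ⟨hv, h⟩)⟩
    choose S hS hdom using hpart
    refine ⟨univ.biUnion S, ?_, fun v hv => ?_⟩
    · calc (univ.biUnion S).card ≤ (univ : Finset (Fin k)).card * (k ^ m * gfun ε) :=
            card_biUnion_le_card_mul _ _ _ fun i _ => hS i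
        _ = k ^ (m + 1) * gfun ε := by
            rw [card_univ, Fintype.card_fin]
            ring
    · obtain ⟨i, hi⟩ := hheavy v hv
      obtain ⟨s, hs, hsv⟩ := hdom i v hv hi
      exact ⟨s, mem_biUnion.2 ⟨i, mem_univ i, hs⟩, hsv⟩

/-- Let `k ≥ 1` and let `T` be a complete multidigraph on a finite nonempty vertex set `V`
whose arc set is the union of `k` quasi-orders `P 1, …, P k`. Then the domination number of
`T` is at most `k^(k+1) · g(1/(2k))`: there is a set `S ⊆ V` of at most that many vertices
such that every vertex `v` satisfies `v ∈ S` or `P i s v` for some `s ∈ S` and some `i`. -/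
theorem domination_number_le
    {V : Type*} [Fintype V] [Nonempty V] {k : ℕ} (hk : 1 ≤ k)
    (P : Fin k → V → V → Prop)
    (hrefl : ∀ i x, P i x x)
    (htrans : ∀ i x y z, P i x y → P i y z → P i x z)
    (hcomplete : ∀ x y : V, x ≠ y → ∃ i, P i x y ∨ P i y x) :
    ∃ S : Finset V,
      S.card ≤ k ^ (k + 1) * gfun (1 / (2 * (k : ℝ))) ∧
      ∀ v : V, v ∈ S ∨ ∃ s ∈ S, ∃ i : Fin k, P i s v := by
  have htotal : ∀ x y : V, (∃ i, P i x y) ∨ ∃ i, P i y x := by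
    intro x y
    rcases eq_or_ne x y with rfl | hxy
    · exact Or.inl ⟨⟨0, hk⟩, hrefl _ x⟩
    · exact exists_or.1 (hcomplete x y hxy)
  obtain ⟨S, hS, hdom⟩ := exists_dominating_of_heavy_colours hk P htrans htotal (k + 1) ∅
    (by simp) (fun _ _ => 0) Finset.univ (by simp)
  exact ⟨S, hS, fun v => Or.inr (hdom v (Finset.mem_univ v))⟩
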